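/- arXiv:1601.03438 — 2 statements merged into one kernel-verified Lean document; each statement's English description precedes it below -/
import Mathlib

section
/- Let M be an R-module projective in σ[M] and a semiprime module. Then for every annihilator submodule N of M (i.e., N = Ann_M(K) for some submodule K ⊆ M), one has Ann_M(Ann_M(N)) = N. -/
/- Common definitions: the category σ[M], projectivity in σ[M], the product
   K_M L of submodules, annihilators, prime/semiprime submodules, hereditary
   torsion theories, M-singular modules, etc., following the paper. -/

universe u v

section Defs

variable (R : Type u) [Ring R]

/-- `N` belongs to `σ[M]`: `N` is isomorphic to a submodule of an `M`-generated
module, i.e. `N` embeds into a quotient of a direct sum of copies of `M`. -/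
def InSigma (M : Type v) [AddCommGroup M] [Module R M]
    (N : Type v) [AddCommGroup N] [Module R N] : Prop :=
  ∃ (ι : Type v) (K : Submodule R (ι →₀ M)) (g : N →ₗ[R] ((ι →₀ M) ⧸ K)),
    Function.Injective g

/-- `M` is projective in `σ[M]`. -/
def ProjInSigma (M : Type v) [AddCommGroup M] [Module R M] : Prop :=
  ∀ (A B : Type v) [AddCommGroup A] [Module R A] [AddCommGroup B] [Module R B],
    InSigma R M A → InSigma R M B →
      ∀ (p : A →ₗ[R] B), Function.Surjective p →
        ∀ f : M →ₗ[R] B, ∃ g : M →ₗ[R] A, p.comp g = f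

variable (M : Type v) [AddCommGroup M] [Module R M]

/-- The product `K_M L = Σ { f(K) : f ∈ Hom_R(M, L) }` of submodules of `M`. -/
def prodM (K L : Submodule R M) : Submodule R M :=
  ⨆ f ∈ {f : M →ₗ[R] M | LinearMap.range f ≤ L}, Submodule.map f K

/-- `Ann_M(X) = ∩ { ker f : f ∈ Hom_R(M, X) }`. -/
def annM (X : Type v) [AddCommGroup X] [Module R X] : Submodule R M :=
  ⨅ f : M →ₗ[R] X, LinearMap.ker f

/-- The right annihilator `Ann_M^r(N) = Σ { L ⊆ M : N_M L = 0 }`. -/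
def annMr (N : Submodule R M) : Submodule R M :=
  sSup {L : Submodule R M | prodM R M N L = ⊥}

/-- A submodule is fully invariant if it is stable under all endomorphisms. -/
def IsFullyInvariant (N : Submodule R M) : Prop :=
  ∀ f : M →ₗ[R] M, Submodule.map f N ≤ N

/-- `M` is a semiprime module: `K_M K = 0` implies `K = 0`. -/
def IsSemiprime : Prop :=
  ∀ K : Submodule R M, prodM R M K K = ⊥ → K = ⊥

/-- `P` is prime in `M`. -/
def PrimeIn (P : Submodule R M) : Prop :=
  P ≠ ⊤ ∧ IsFullyInvariant R M P ∧
    ∀ K L : Submodule R M, IsFullyInvariant R M K → IsFullyInvariant R M L →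
      prodM R M K L ≤ P → K ≤ P ∨ L ≤ P

/-- `P` is a minimal prime in `M`. -/
def MinPrimeIn (P : Submodule R M) : Prop :=
  PrimeIn R M P ∧ ∀ Q : Submodule R M, PrimeIn R M Q → Q ≤ P → Q = P

/-- Powers of a submodule: `powM N k = N^(k+1)`, i.e. `powM N 0 = N` and
`powM N (k+1) = N_M (powM N k)`. -/
def powM (N : Submodule R M) : ℕ → Submodule R M
  | 0 => N
  | k + 1 => prodM R M N (powM N k)

/-- The set of annihilator submodules `∩_{f ∈ X} ker f` for `X ⊆ End_R(M)`. -/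
def AnnSet : Set (Submodule R M) :=
  {N | ∃ X : Set (M →ₗ[R] M), N = ⨅ f ∈ X, LinearMap.ker f}

/-- `M` satisfies ACC on annihilators. -/
def AccOnAnnihilators : Prop :=
  ∀ c : ℕ → Submodule R M, (∀ n, c n ∈ AnnSet R M) → Monotone c →
    ∃ n, ∀ m, n ≤ m → c m = c n

/-- `U` is a uniform submodule of `M`. -/
def UniformSub (U : Submodule R M) : Prop :=
  U ≠ ⊥ ∧ ∀ A B : Submodule R M, A ≤ U → B ≤ U → A ≠ ⊥ → B ≠ ⊥ → A ⊓ B ≠ ⊥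

end Defs

section Torsion

variable (R : Type u) [Ring R]

/-- A hereditary torsion theory, presented via its torsion class: a class of
modules closed under submodules, quotients, extensions, isomorphisms and
direct sums. -/
structure HTC : Type (max u (v + 1)) where
  torsion : ∀ (N : Type v) [AddCommGroup N] [Module R N], Prop
  closed_sub : ∀ (N : Type v) [AddCommGroup N] [Module R N],
    torsion N → ∀ K : Submodule R N, torsion K
  closed_quot : ∀ (N : Type v) [AddCommGroup N] [Module R N],
    torsion N → ∀ K : Submodule R N, torsion (N ⧸ K)
  closed_ext : ∀ (N : Type v) [AddCommGroup N] [Module R N] (K : Submodule R N),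
    torsion K → torsion (N ⧸ K) → torsion N
  closed_iso : ∀ (N N' : Type v) [AddCommGroup N] [Module R N]
    [AddCommGroup N'] [Module R N'], (N ≃ₗ[R] N') → torsion N → torsion N'
  closed_dsum : ∀ (ι : Type v) (F : ι → Type v) [DecidableEq ι]
    [∀ i, AddCommGroup (F i)] [∀ i, Module R (F i)],
    (∀ i, torsion (F i)) → torsion (DirectSum ι F)

/-- `N` is `τ`-torsion-free. -/
def TorsionFreeFor (τ : HTC.{u, v} R) (N : Type v) [AddCommGroup N] [Module R N] : Prop :=
  ∀ K : Submodule R N, τ.torsion ↥K → K = ⊥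

variable (M : Type v) [AddCommGroup M] [Module R M]

/-- `N` is `χ(M)`-torsion: torsion for some (hence for the greatest) hereditary
torsion theory for which `M` is torsion-free. -/
def ChiTorsion (N : Type v) [AddCommGroup N] [Module R N] : Prop :=
  ∃ τ : HTC.{u, v} R, TorsionFreeFor R τ M ∧ τ.torsion N

/-- `N` is `χ(M)`-torsion-free. -/
def ChiTorsionFree (N : Type v) [AddCommGroup N] [Module R N] : Prop :=
  ∀ K : Submodule R N, ChiTorsion R M ↥K → K = ⊥

/-- `X` is `M`-singular: `X ≅ L/K` with `L ∈ σ[M]` and `K` essential in `L`. -/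
def IsMSingular (X : Type v) [AddCommGroup X] [Module R X] : Prop :=
  ∃ (L : Type v) (iL : AddCommGroup L)
    (mL : @Module R L inferInstance iL.toAddCommMonoid),
    letI := iL
    letI := mL
    InSigma R M L ∧ ∃ K : Submodule R L,
      (∀ K' : Submodule R L, K' ≠ ⊥ → K ⊓ K' ≠ ⊥) ∧ Nonempty (X ≃ₗ[R] (L ⧸ K))

/-- The `M`-singular submodule `Z(M)` of `M`. -/
def singularSub : Submodule R M :=
  sSup {K : Submodule R M | IsMSingular R M ↥K}

/-- `Ass_M(X)`: the set of primes in `M` associated to `X`. -/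
def AssM (X : Type v) [AddCommGroup X] [Module R X] : Set (Submodule R M) :=
  {P | P ≠ ⊤ ∧ IsFullyInvariant R M P ∧
    ∃ L : Submodule R X, L ≠ ⊥ ∧
      ∀ L' : Submodule R X, L' ≠ ⊥ → L' ≤ L → annM R M ↥L' = P}

/-- `E` is an injective object of `σ[M]`. -/
def InjInSigma (E : Type v) [AddCommGroup E] [Module R E] : Prop :=
  InSigma R M E ∧
    ∀ (B : Type v) [AddCommGroup B] [Module R B], InSigma R M B →
      ∀ (A : Submodule R B) (f : ↥A →ₗ[R] E),
        ∃ g : B →ₗ[R] E, ∀ a : A, g ↑a = f a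

/-- `E` is an indecomposable module. -/
def Indecomp (E : Type v) [AddCommGroup E] [Module R E] : Prop :=
  (⊥ : Submodule R E) ≠ ⊤ ∧
    ∀ A B : Submodule R E, IsCompl A B → A = ⊥ ∨ A = ⊤

/-- `M` has finite uniform dimension: there is no infinite independent family
of nonzero submodules. -/
def FiniteUniformDimension : Prop :=
  ¬ ∃ f : ℕ → Submodule R M, (∀ n, f n ≠ ⊥) ∧
      ∀ n : ℕ, f n ⊓ (⨆ m ∈ {m : ℕ | m ≠ n}, f m) = ⊥

/-- `M` is a continuous module (conditions C1 and C2). -/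
def ContinuousModule : Prop :=
  (∀ N : Submodule R M, ∃ D : Submodule R M, (∃ D', IsCompl D D') ∧ N ≤ D ∧
      ∀ L : Submodule R M, L ≤ D → L ≠ ⊥ → N ⊓ L ≠ ⊥) ∧
  (∀ N D : Submodule R M, (∃ D', IsCompl D D') → Nonempty (↥N ≃ₗ[R] ↥D) →
      ∃ N', IsCompl N N')

end Torsion

theorem inSigma_of_injective {R : Type u} [Ring R] {M A ι : Type v} [AddCommGroup M] [Module R M]
    [AddCommGroup A] [Module R A] (g : A →ₗ[R] (ι →₀ M)) (hg : Function.Injective g) :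
    InSigma R M A := by
  refine ⟨ι, ⊥, (Submodule.quotEquivOfEqBot (⊥ : Submodule R (ι →₀ M)) rfl).symm.toLinearMap.comp g, ?_⟩
  exact (Submodule.quotEquivOfEqBot (⊥ : Submodule R (ι →₀ M)) rfl).symm.injective.comp hg

theorem le_annM_iff {R : Type u} [Ring R] {M : Type v} [AddCommGroup M] [Module R M]
    {K L : Submodule R M} : K ≤ annM R M ↥L ↔ ∀ f : M →ₗ[R] ↥L, ∀ x ∈ K, f x = 0 := by
  simp only [annM, le_iInf_iff]
  rfl

theorem annM_anti {R : Type u} [Ring R] {M : Type v} [AddCommGroup M] [Module R M]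
    {K L : Submodule R M} (h : K ≤ L) : annM R M ↥L ≤ annM R M ↥K := by
  refine le_annM_iff.2 fun f x hx => Submodule.inclusion_injective h ?_
  rw [map_zero]
  exact le_annM_iff.1 le_rfl ((Submodule.inclusion h).comp f) x hx

/-- Over a semiprime module projective in `σ[M]`, `K_M L = 0` implies `L_M K = 0`. -/
theorem le_annM_symm {R : Type u} [Ring R] {M : Type v} [AddCommGroup M] [Module R M]
    (hproj : ProjInSigma R M) (hsemi : IsSemiprime R M) {K L : Submodule R M}
    (h : K ≤ annM R M ↥L) : L ≤ annM R M ↥K := by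
  let p : ((M →ₗ[R] ↥K) →₀ ↥L) →ₗ[R] M :=
    Finsupp.lsum ℕ fun f => K.subtype.comp (f.comp L.subtype)
  have p_apply (c : (M →ₗ[R] ↥K) →₀ ↥L) : p c = c.sum fun f l => (f (l : M) : M) := rfl
  have range_le : LinearMap.range p ≤ K := by
    rintro _ ⟨c, rfl⟩
    rw [p_apply]
    exact Submodule.sum_mem _ fun f _ => (f _).2
  have range_eq_bot : LinearMap.range p = ⊥ := by
    apply hsemi
    refine le_bot_iff.1 (iSup₂_le fun g (hg : LinearMap.range g ≤ _) => ?_)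
    obtain ⟨q, hq⟩ := hproj _ _
      (inSigma_of_injective (Finsupp.mapRange.linearMap L.subtype)
        (Finsupp.mapRange_injective _ rfl L.injective_subtype))
      (inSigma_of_injective ((Finsupp.lsingle PUnit.unit).comp (LinearMap.range p).subtype)
        ((Finsupp.single_injective _).comp (Submodule.injective_subtype _)))
      p.rangeRestrict p.surjective_rangeRestrict
      (g.codRestrict (LinearMap.range p) fun x => hg ⟨x, rfl⟩)
    rintro _ ⟨x, hx, rfl⟩
    have q_eq_zero : q x = 0 := by
      ext f
      exact congrArg Subtype.val
        (le_annM_iff.1 h ((Finsupp.lapply f).comp q) x (range_le hx))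
    have g_eq : p (q x) = g x := congrArg Subtype.val (LinearMap.congr_fun hq x)
    rw [Submodule.mem_bot, ← g_eq, q_eq_zero, map_zero]
  refine le_annM_iff.2 fun f x hx => Subtype.ext ?_
  have hfx : p (Finsupp.single f ⟨x, hx⟩) = f x := by
    rw [p_apply, Finsupp.sum_single_index (by simp)]
  have hmem : p (Finsupp.single f ⟨x, hx⟩) ∈ LinearMap.range p := ⟨_, rfl⟩
  rwa [range_eq_bot, Submodule.mem_bot, hfx] at hmem

/-- in a semiprime module, `Ann_M(Ann_M(N)) = N` for every
annihilator submodule `N`. -/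
theorem stmt_9 (R : Type u) [Ring R] (M : Type v) [AddCommGroup M] [Module R M]
    (hproj : ProjInSigma R M) (hsemi : IsSemiprime R M)
    (N K : Submodule R M) (hN : N = annM R M ↥K) :
    annM R M ↥(annM R M ↥N) = N := by
  apply le_antisymm
  · have hK : K ≤ annM R M ↥N := le_annM_symm hproj hsemi hN.le
    exact (annM_anti hK).trans hN.ge
  · exact le_annM_symm hproj hsemi le_rfl
end

section
/- Let M be an R-module projective in σ[M] and a semiprime module satisfying ACC on annihilators. Then M has only finitely many minimal prime in M submodules; if P_1, ..., P_n are these minimal primes, then P_1 ∩ P_2 ∩ ... ∩ P_n = 0; and a prime in M submodule P is a minimal prime in M if and only if P is an annihilator submodule. -/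
/- Common definitions: the category σ[M], projectivity in σ[M], the product
   K_M L of submodules, annihilators, prime/semiprime submodules, hereditary
   torsion theories, M-singular modules, etc., following the paper. -/

universe u v

section AnnihilatorLattice

variable {R : Type u} [Ring R] {M : Type v} [AddCommGroup M] [Module R M]

theorem prodM_le_iff {K L N : Submodule R M} :
    prodM R M K L ≤ N ↔ ∀ f : M →ₗ[R] M, LinearMap.range f ≤ L → K.map f ≤ N := by
  simp [prodM]

theorem map_le_prodM {K L : Submodule R M} {f : M →ₗ[R] M} (hf : LinearMap.range f ≤ L) :
    K.map f ≤ prodM R M K L :=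
  prodM_le_iff.1 le_rfl f hf

theorem prodM_mono {K K' L L' : Submodule R M} (hK : K ≤ K') (hL : L ≤ L') :
    prodM R M K L ≤ prodM R M K' L' :=
  prodM_le_iff.2 fun _ hf => (Submodule.map_mono hK).trans (map_le_prodM (hf.trans hL))

theorem prodM_le_right (K L : Submodule R M) : prodM R M K L ≤ L :=
  prodM_le_iff.2 fun _ hf => (LinearMap.map_le_range).trans hf

theorem IsFullyInvariant.prodM_le_left {K : Submodule R M} (hK : IsFullyInvariant R M K)
    (L : Submodule R M) : prodM R M K L ≤ K :=
  prodM_le_iff.2 fun f _ => hK f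

theorem prodM_bot_left (L : Submodule R M) : prodM R M ⊥ L = ⊥ :=
  eq_bot_iff.2 <| prodM_le_iff.2 fun _ _ => by simp

theorem prodM_bot_right (K : Submodule R M) : prodM R M K ⊥ = ⊥ :=
  eq_bot_iff.2 (prodM_le_right K ⊥)

theorem le_annM_iff_s10 {N K : Submodule R M} : N ≤ annM R M K ↔ prodM R M N K = ⊥ := by
  rw [← le_bot_iff, prodM_le_iff, annM, le_iInf_iff]
  constructor
  · intro h f hf
    rintro _ ⟨x, hx, rfl⟩
    have := h (f.codRestrict K fun y => hf ⟨y, rfl⟩) hx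
    simpa [Subtype.ext_iff] using this
  · intro h f x hx
    have := h (K.subtype.comp f) (by rintro _ ⟨y, rfl⟩; exact (f y).2) ⟨x, hx, rfl⟩
    simpa using this

theorem isFullyInvariant_annM (K : Submodule R M) : IsFullyInvariant R M (annM R M K) := by
  rintro g _ ⟨x, hx, rfl⟩
  simp only [annM, SetLike.mem_coe, Submodule.mem_iInf, LinearMap.mem_ker] at hx ⊢
  exact fun f => hx (f.comp g)

theorem annM_mem_annSet (K : Submodule R M) : annM R M K ∈ AnnSet R M := by
  refine ⟨{f | LinearMap.range f ≤ K}, le_antisymm ?_ ?_⟩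
  · simp only [le_iInf_iff]
    exact fun f hf => LinearMap.le_ker_iff_map.2 <|
      le_bot_iff.1 <| prodM_le_iff.1 (le_annM_iff_s10.1 le_rfl).le f hf
  · refine le_annM_iff_s10.2 (le_bot_iff.1 <| prodM_le_iff.2 fun f hf => ?_)
    exact (LinearMap.le_ker_iff_map.1 (iInf₂_le f hf)).le

theorem InSigma.of_injective {ι : Type v} {N : Type v} [AddCommGroup N] [Module R N]
    (g : N →ₗ[R] (ι →₀ M)) (hg : Function.Injective g) : InSigma R M N :=
  ⟨ι, ⊥, (Submodule.quotEquivOfEqBot ⊥ rfl).symm.toLinearMap.comp g,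
    (Submodule.quotEquivOfEqBot ⊥ rfl).symm.injective.comp hg⟩

theorem InSigma.submodule (N : Submodule R M) : InSigma R M N :=
  .of_injective (ι := PUnit) ((Finsupp.lsingle PUnit.unit).comp N.subtype)
    ((Finsupp.single_injective _).comp N.injective_subtype)

theorem InSigma.finsupp (ι : Type v) (N : Submodule R M) : InSigma R M (ι →₀ N) :=
  .of_injective (Finsupp.mapRange.linearMap N.subtype)
    (Finsupp.mapRange_injective _ (map_zero _) N.injective_subtype)

/-- Projectivity lifts a map `M → B_M C` to a direct sum of copies of `B`. -/
theorem ProjInSigma.prodM_assoc_le (hproj : ProjInSigma R M) (A B C : Submodule R M) :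
    prodM R M A (prodM R M B C) ≤ prodM R M (prodM R M A B) C := by
  refine prodM_le_iff.2 fun f hf => ?_
  let Λ := {g : M →ₗ[R] M // LinearMap.range g ≤ C}
  let s : (Λ →₀ B) →ₗ[R] M := Finsupp.lsum ℕ fun g : Λ => g.1.comp B.subtype
  have hs : LinearMap.range s = prodM R M B C := by
    apply le_antisymm
    · rintro _ ⟨x, rfl⟩
      simp only [s, Finsupp.lsum_apply]
      exact Submodule.sum_mem _ fun g _ => map_le_prodM g.2 ⟨x g, (x g).2, rfl⟩
    · refine prodM_le_iff.2 fun g hg => ?_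
      rintro _ ⟨b, hb, rfl⟩
      exact ⟨Finsupp.single ⟨g, hg⟩ ⟨b, hb⟩, by simp [s]⟩
  obtain ⟨h, hh⟩ := hproj (Λ →₀ B) (LinearMap.range s) (.finsupp Λ B) (.submodule _)
    s.rangeRestrict s.surjective_rangeRestrict
    (f.codRestrict _ fun x => hs ▸ hf ⟨x, rfl⟩)
  rintro _ ⟨a, ha, rfl⟩
  have hfa : f a = s (h a) := by
    have := congrArg Subtype.val (LinearMap.congr_fun hh a)
    simpa using this.symm
  rw [hfa]
  simp only [s, Finsupp.lsum_apply]
  refine Submodule.sum_mem _ fun g _ => map_le_prodM g.2 ⟨h a g, ?_, rfl⟩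
  have hr : LinearMap.range (B.subtype.comp ((Finsupp.lapply g).comp h)) ≤ B := by
    rintro _ ⟨y, rfl⟩
    exact (h y g).2
  exact map_le_prodM hr ⟨a, ha, rfl⟩

theorem prodM_assoc_ge (A B C : Submodule R M) :
    prodM R M (prodM R M A B) C ≤ prodM R M A (prodM R M B C) := by
  refine prodM_le_iff.2 fun g hg => Submodule.map_le_iff_le_comap.2 <|
    prodM_le_iff.2 fun f hf => Submodule.map_le_iff_le_comap.1 ?_
  rw [← Submodule.map_comp]
  refine map_le_prodM ?_
  rw [LinearMap.range_comp]
  exact (Submodule.map_mono hf).trans (map_le_prodM hg)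

theorem ProjInSigma.prodM_assoc (hproj : ProjInSigma R M) (A B C : Submodule R M) :
    prodM R M (prodM R M A B) C = prodM R M A (prodM R M B C) :=
  le_antisymm (prodM_assoc_ge A B C) (hproj.prodM_assoc_le A B C)

theorem IsSemiprime.prodM_eq_bot_symm (hsemi : IsSemiprime R M) (hproj : ProjInSigma R M)
    {A B : Submodule R M} (h : prodM R M A B = ⊥) : prodM R M B A = ⊥ := by
  apply hsemi
  rw [hproj.prodM_assoc, ← hproj.prodM_assoc A, h, prodM_bot_left, prodM_bot_right]

theorem IsSemiprime.eq_bot_of_le_annM (hsemi : IsSemiprime R M) {K : Submodule R M}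
    (h : K ≤ annM R M K) : K = ⊥ :=
  hsemi K (le_annM_iff_s10.1 h)

theorem IsSemiprime.le_annM_comm (hsemi : IsSemiprime R M) (hproj : ProjInSigma R M)
    {A B : Submodule R M} : A ≤ annM R M B ↔ B ≤ annM R M A := by
  rw [le_annM_iff_s10, le_annM_iff_s10]
  exact ⟨hsemi.prodM_eq_bot_symm hproj, hsemi.prodM_eq_bot_symm hproj⟩

theorem IsSemiprime.le_annM_annM (hsemi : IsSemiprime R M) (hproj : ProjInSigma R M)
    (A : Submodule R M) : A ≤ annM R M (annM R M A) :=
  (hsemi.le_annM_comm hproj).1 le_rfl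

theorem annM_anti_s10 {A B : Submodule R M} (h : A ≤ B) : annM R M B ≤ annM R M A :=
  le_annM_iff_s10.2 <| le_bot_iff.1 <| (prodM_mono le_rfl h).trans (le_annM_iff_s10.1 le_rfl).le

theorem IsSemiprime.annM_annM_annM (hsemi : IsSemiprime R M) (hproj : ProjInSigma R M)
    (A : Submodule R M) : annM R M (annM R M (annM R M A)) = annM R M A :=
  le_antisymm (annM_anti_s10 (hsemi.le_annM_annM hproj A)) (hsemi.le_annM_annM hproj _)

theorem annM_bot : annM R M (⊥ : Submodule R M) = ⊤ :=
  top_le_iff.1 <| le_annM_iff_s10.2 (prodM_bot_right _)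

theorem IsSemiprime.eq_bot_of_annM_eq_top (hsemi : IsSemiprime R M) {K : Submodule R M}
    (h : annM R M K = ⊤) : K = ⊥ :=
  hsemi.eq_bot_of_le_annM (h ▸ le_top)

theorem AccOnAnnihilators.exists_maximal (hacc : AccOnAnnihilators R M)
    {T : Set (Submodule R M)} (hT : T.Nonempty)
    (hann : ∀ N ∈ T, ∃ K : Submodule R M, N = annM R M K) :
    ∃ N, Maximal (· ∈ T) N := by
  have hwf : WellFoundedGT (AnnSet R M) := by
    refine wellFoundedGT_iff_monotone_chain_condition.2 fun c => ?_
    obtain ⟨n, hn⟩ := hacc (fun i => c i) (fun i => (c i).2) fun i j hij => c.monotone hij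
    exact ⟨n, fun m hm => Subtype.ext (hn m hm).symm⟩
  have hT' : ∀ N ∈ T, N ∈ AnnSet R M := fun N hN => by
    obtain ⟨K, rfl⟩ := hann N hN
    exact annM_mem_annSet K
  obtain ⟨N₀, hN₀⟩ := hT
  obtain ⟨N, hN, hmax⟩ := hwf.wf.has_min {N : AnnSet R M | N.1 ∈ T} ⟨⟨N₀, hT' _ hN₀⟩, hN₀⟩
  refine ⟨N, hN, fun L hL hNL => ?_⟩
  by_contra hLN
  exact hmax ⟨L, hT' L hL⟩ hL (lt_of_le_not_ge hNL hLN)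

/-- `P` is maximal among the proper annihilator submodules. -/
def IsMaxAnnihilator (P : Submodule R M) : Prop :=
  Maximal (fun N => N ≠ ⊤ ∧ ∃ K : Submodule R M, N = annM R M K) P

theorem AccOnAnnihilators.exists_le_isMaxAnnihilator (hacc : AccOnAnnihilators R M)
    {K : Submodule R M} (hK : annM R M K ≠ ⊤) :
    ∃ P : Submodule R M, annM R M K ≤ P ∧ IsMaxAnnihilator P := by
  obtain ⟨P, ⟨hKP, hP⟩, hmax⟩ := hacc.exists_maximal
    (T := {N | annM R M K ≤ N ∧ N ≠ ⊤ ∧ ∃ K : Submodule R M, N = annM R M K})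
    ⟨_, le_rfl, hK, K, rfl⟩ fun _ hN => hN.2.2
  exact ⟨P, hKP, hP, fun L hL hPL => hmax ⟨hKP.trans hPL, hL⟩ hPL⟩

theorem IsMaxAnnihilator.primeIn {P : Submodule R M} (hP : IsMaxAnnihilator P)
    (hproj : ProjInSigma R M) (hsemi : IsSemiprime R M) : PrimeIn R M P := by
  obtain ⟨⟨hne, K, rfl⟩, hmax⟩ := hP
  refine ⟨hne, isFullyInvariant_annM K, fun A B _ _ hAB => or_iff_not_imp_right.2 fun hB => ?_⟩
  have hA : A ≤ annM R M (prodM R M B K) := by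
    rw [le_annM_iff_s10, ← hproj.prodM_assoc]
    exact le_annM_iff_s10.1 hAB
  refine hA.trans (hmax ⟨fun h => hB ?_, _, rfl⟩ (annM_anti_s10 (prodM_le_right B K)))
  exact le_annM_iff_s10.2 (hsemi.eq_bot_of_annM_eq_top h)

theorem PrimeIn.minPrimeIn_of_eq_annM {P K : Submodule R M} (hP : PrimeIn R M P)
    (hPK : P = annM R M K) (hproj : ProjInSigma R M) (hsemi : IsSemiprime R M) :
    MinPrimeIn R M P := by
  refine ⟨hP, fun Q hQ hQP => le_antisymm hQP ?_⟩
  have hPP : P = annM R M (annM R M P) := by rw [hPK, hsemi.annM_annM_annM hproj]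
  have hprod : prodM R M P (annM R M P) ≤ Q := by
    rw [le_annM_iff_s10.1 hPP.le]
    exact bot_le
  refine (hQ.2.2 _ _ hP.2.1 (isFullyInvariant_annM P) hprod).resolve_right fun h => hP.1 ?_
  rw [hPP, hsemi.eq_bot_of_le_annM ((h.trans hQP).trans hPP.le), annM_bot]

theorem PrimeIn.exists_mem_le_of_inf_le {Q : Submodule R M} (hQ : PrimeIn R M Q)
    (F : Finset (Submodule R M)) (hF : ∀ P ∈ F, IsFullyInvariant R M P)
    (h : F.inf id ≤ Q) : ∃ P ∈ F, P ≤ Q := by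
  classical
  induction F using Finset.induction_on with
  | empty => exact (hQ.1 (top_le_iff.1 h)).elim
  | insert P F _ ih =>
    have hF' : ∀ P ∈ F, IsFullyInvariant R M P := fun P hP => hF P (Finset.mem_insert_of_mem hP)
    have hinf : IsFullyInvariant R M (F.inf id) := fun f => Finset.le_inf fun P hP =>
      (Submodule.map_mono (Finset.inf_le hP)).trans (hF' P hP f)
    have hPi := hF P (Finset.mem_insert_self P F)
    rw [Finset.inf_insert] at h
    rcases hQ.2.2 P (F.inf id) hPi hinf
      ((le_inf (hPi.prodM_le_left _) (prodM_le_right _ _)).trans h) with hle | hle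
    · exact ⟨P, Finset.mem_insert_self P F, hle⟩
    · obtain ⟨P', hP', hle'⟩ := ih hF' hle
      exact ⟨P', Finset.mem_insert_of_mem hP', hle'⟩

theorem AccOnAnnihilators.exists_finset_inf_eq_bot (hacc : AccOnAnnihilators R M)
    (hproj : ProjInSigma R M) (hsemi : IsSemiprime R M) :
    ∃ F : Finset (Submodule R M), (∀ P ∈ F, IsMaxAnnihilator P) ∧ F.inf id = ⊥ := by
  classical
  obtain ⟨_, ⟨F, hF, rfl⟩, hmax⟩ := hacc.exists_maximal
    (T := {N | ∃ F : Finset (Submodule R M),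
      (∀ P ∈ F, IsMaxAnnihilator P) ∧ annM R M (F.inf id : Submodule R M) = N})
    ⟨_, ∅, by simp, rfl⟩ (by rintro _ ⟨F, -, rfl⟩; exact ⟨_, rfl⟩)
  refine ⟨F, hF, ?_⟩
  by_contra hne
  obtain ⟨P, hDP, hP⟩ := hacc.exists_le_isMaxAnnihilator
    fun h => hne (hsemi.eq_bot_of_annM_eq_top h)
  obtain ⟨K, hK⟩ := hP.prop.2
  have hPP : annM R M (annM R M P) = P := by rw [hK, hsemi.annM_annM_annM hproj]
  have hle : annM R M ((insert P F).inf id : Submodule R M) ≤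
      annM R M (F.inf id : Submodule R M) :=
    hmax ⟨insert P F, by simpa using ⟨hP, hF⟩, rfl⟩
      (annM_anti_s10 (Finset.inf_mono (Finset.subset_insert P F)))
  have hPD : annM R M P ≤ P :=
    ((annM_anti_s10 (Finset.inf_le (f := id) (Finset.mem_insert_self P F))).trans hle).trans hDP
  apply hP.prop.1
  rw [← hPP, hsemi.eq_bot_of_le_annM (hPD.trans hPP.ge), annM_bot]

end AnnihilatorLattice

/-- Theorem 2.2: a semiprime module with ACC on annihilators
has finitely many minimal primes, their intersection is `0`, and a prime in
`M` is minimal iff it is an annihilator submodule. -/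
theorem stmt_10 (R : Type u) [Ring R] (M : Type v) [AddCommGroup M] [Module R M]
    (hproj : ProjInSigma R M) (hsemi : IsSemiprime R M)
    (hacc : AccOnAnnihilators R M) :
    {P : Submodule R M | MinPrimeIn R M P}.Finite ∧
      sInf {P : Submodule R M | MinPrimeIn R M P} = ⊥ ∧
      ∀ P : Submodule R M, PrimeIn R M P →
        (MinPrimeIn R M P ↔ ∃ K : Submodule R M, P = annM R M ↥K) := by
  obtain ⟨F, hF, hFbot⟩ := hacc.exists_finset_inf_eq_bot hproj hsemi
  have hFmin : ∀ P ∈ F, MinPrimeIn R M P := fun P hP => by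
    obtain ⟨K, hK⟩ := (hF P hP).prop.2
    exact ((hF P hP).primeIn hproj hsemi).minPrimeIn_of_eq_annM hK hproj hsemi
  have hmem : ∀ Q : Submodule R M, MinPrimeIn R M Q → Q ∈ F := fun Q hQ => by
    obtain ⟨P, hP, hPQ⟩ := hQ.1.exists_mem_le_of_inf_le F (fun P hP => (hFmin P hP).1.2.1)
      (hFbot ▸ bot_le)
    exact hQ.2 P (hFmin P hP).1 hPQ ▸ hP
  refine ⟨F.finite_toSet.subset hmem, eq_bot_iff.2 ?_, fun P hP => ⟨fun h => ?_, ?_⟩⟩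
  · rw [← hFbot]
    exact Finset.le_inf fun P hP => sInf_le (hFmin P hP)
  · exact (hF P (hmem P h)).prop.2
  · rintro ⟨K, hK⟩
    exact hP.minPrimeIn_of_eq_annM hK hproj hsemi
end
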